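/- arXiv:1501.01695 — 2 statements merged into one kernel-verified Lean document; each statement's English description precedes it below -/
import Mathlib

section
/- Let n ∈ ℕ, fix x₀ ∈ ℝ^n with ‖x₀‖ = 1, and let c_g be a positive constant with the order-statistics property below. Then for every 0 < α < 1 and every ε with 0 < ε < min((1 − √α)/4, c_g² ln 2, 1/(2c_g²)), one has ((1 − √α)/32)·ε/ln(1/ε) < β̊^max_{ε,α} < (1/(4c_g²))·ε/ln(1/ε). -/
open MeasureTheory ProbabilityTheory Real

/-- The canonical probability space of `m` i.i.d. standard Gaussian random variables. -/
noncomputable def stdGaussianPi (m : ℕ) : Measure (Fin m → ℝ) :=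
  Measure.pi fun _ => gaussianReal 0 1

/-- The law of an `m × n` Gaussian random matrix with i.i.d. `N(0,1)` entries. -/
noncomputable def gaussianMatrix (m n : ℕ) : Measure (Fin m → Fin n → ℝ) :=
  Measure.pi fun _ => Measure.pi fun _ => gaussianReal 0 1

/-- `absOrd y j = |Y_(j+1)|`: the `(j+1)`-st largest among `|y 0|, …, |y (m-1)|`. -/
noncomputable def absOrd {m : ℕ} (y : Fin m → ℝ) (j : Fin m) : ℝ :=
  |y (Tuple.sort (fun i => -|y i|) j)|

/-- `c` has the order-statistics property: `c √(ln(2m/(j+1))) ≤ E|Y_(j+1)|` for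
all `m` and all `j+1 ≤ m/2`. -/
def cgProperty (c : ℝ) : Prop :=
  ∀ (m : ℕ) (j : Fin m), 2 * ((j : ℕ) + 1) ≤ m →
    c * Real.sqrt (Real.log (2 * m / ((j : ℕ) + 1))) ≤ ∫ y, absOrd y j ∂(stdGaussianPi m)

/-- `‖A_T x‖²`. -/
noncomputable def subNormSq {m n : ℕ} (A : Fin m → Fin n → ℝ) (x : Fin n → ℝ)
    (T : Finset (Fin m)) : ℝ :=
  ∑ i ∈ T, (∑ j, A i j * x j) ^ 2

/-- The event `Ω̊_{ε,β}`: `|(1/m)‖A_T x₀‖² − 1| ≤ ε` for all `T` with `|Tᶜ| ≤ βm`. -/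
def omegaRingEvent (m n : ℕ) (x₀ : Fin n → ℝ) (ε β : ℝ) : Set (Fin m → Fin n → ℝ) :=
  {A | ∀ T : Finset (Fin m), (Tᶜ.card : ℝ) ≤ β * m →
    |(1 / (m : ℝ)) * subNormSq A x₀ T - 1| ≤ ε}

/-- `β̊^max_{ε,α}`: the supremum of all `β ∈ [0,1)` such that
`P(Ω̊_{ε,β}) ≥ 1 − 3 e^{−α(ε²/4−ε³/6)m}` for every `m ∈ ℕ` (with `sSup ∅ = 0` in `ℝ`). -/
noncomputable def betaRingMax (n : ℕ) (x₀ : Fin n → ℝ) (ε α : ℝ) : ℝ :=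
  sSup {β : ℝ | 0 ≤ β ∧ β < 1 ∧ ∀ m : ℕ, 0 < m →
    ENNReal.ofReal (1 - 3 * Real.exp (-α * (ε ^ 2 / 4 - ε ^ 3 / 6) * m)) ≤
      gaussianMatrix m n (omegaRingEvent m n x₀ ε β)}


instance isProbabilityMeasure_stdGaussianPi (m : ℕ) :
    IsProbabilityMeasure (stdGaussianPi m) := by
  unfold stdGaussianPi; infer_instance

/-- A unit linear combination of i.i.d. standard Gaussian variables is standard Gaussian. -/
theorem map_pi_gaussianReal_sum_mul {n : ℕ} (x₀ : Fin n → ℝ) (hx₀ : ∑ j, x₀ j ^ 2 = 1) :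
    (stdGaussianPi n).map (fun a => ∑ j, a j * x₀ j) = gaussianReal 0 1 := by
  have hmeas : Measurable fun a : Fin n → ℝ => ∑ j, a j * x₀ j := by fun_prop
  have : IsProbabilityMeasure ((stdGaussianPi n).map fun a => ∑ j, a j * x₀ j) :=
    Measure.isProbabilityMeasure_map hmeas.aemeasurable
  apply Measure.ext_of_charFun
  ext t
  rw [charFun_apply_real, charFun_gaussianReal, integral_map hmeas.aemeasurable (by fun_prop)]
  have h1 : ∀ a : Fin n → ℝ, Complex.exp (t * ((∑ j, a j * x₀ j : ℝ) : ℂ) * Complex.I) =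
      ∏ j, Complex.exp ((t * x₀ j : ℝ) * (a j : ℂ) * Complex.I) := by
    intro a
    rw [← Complex.exp_sum]
    congr 1
    push_cast
    rw [Finset.mul_sum, Finset.sum_mul]
    exact Finset.sum_congr rfl fun j _ => by ring
  simp_rw [h1]
  rw [stdGaussianPi, integral_fintype_prod_eq_prod
    (fun j (a : ℝ) => Complex.exp ((t * x₀ j : ℝ) * (a : ℂ) * Complex.I))]
  simp_rw [← charFun_apply_real, charFun_gaussianReal]
  rw [← Complex.exp_sum]
  congr 1
  have h2 : ∑ j, (t * x₀ j) ^ 2 = t ^ 2 := by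
    simp_rw [mul_pow]
    rw [← Finset.mul_sum, hx₀, mul_one]
  have h3 : (∑ j, ((t : ℂ) * x₀ j) ^ 2) = (t : ℂ) ^ 2 := by exact_mod_cast h2
  simp only [Complex.ofReal_zero, mul_zero, zero_mul, NNReal.coe_one, Complex.ofReal_one, one_mul,
    zero_sub, Complex.ofReal_mul]
  rw [← h3, Finset.sum_div, Finset.sum_neg_distrib]

/-- `Ω̊_{ε,β}` expressed through the Gaussian vector `y = A x₀`. -/
def ringVecEvent (m : ℕ) (ε β : ℝ) : Set (Fin m → ℝ) :=
  {y | ∀ T : Finset (Fin m), (Tᶜ.card : ℝ) ≤ β * m → |(1 / (m : ℝ)) * ∑ i ∈ T, y i ^ 2 - 1| ≤ ε}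

theorem measurableSet_ringVecEvent (m : ℕ) (ε β : ℝ) : MeasurableSet (ringVecEvent m ε β) := by
  have : ringVecEvent m ε β = ⋂ T : Finset (Fin m), ⋂ _ : (Tᶜ.card : ℝ) ≤ β * m,
      {y | |(1 / (m : ℝ)) * ∑ i ∈ T, y i ^ 2 - 1| ≤ ε} := by
    ext y; simp [ringVecEvent]
  rw [this]
  refine MeasurableSet.iInter fun T => MeasurableSet.iInter fun _ => ?_
  exact measurableSet_le (by fun_prop) (by fun_prop)

theorem gaussianMatrix_omegaRingEvent {n : ℕ} (x₀ : Fin n → ℝ) (hx₀ : ∑ j, x₀ j ^ 2 = 1)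
    (m : ℕ) (ε β : ℝ) :
    gaussianMatrix m n (omegaRingEvent m n x₀ ε β) = stdGaussianPi m (ringVecEvent m ε β) := by
  have hmeas : Measurable fun a : Fin n → ℝ => ∑ j, a j * x₀ j := by fun_prop
  have hrow := map_pi_gaussianReal_sum_mul x₀ hx₀
  unfold stdGaussianPi at hrow
  have hmap : (gaussianMatrix m n).map (fun A i => ∑ j, A i j * x₀ j) = stdGaussianPi m := by
    have : ∀ _ : Fin m, SigmaFinite
        ((Measure.pi fun _ : Fin n => gaussianReal 0 1).map fun a => ∑ j, a j * x₀ j) := by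
      intro _; rw [hrow]; infer_instance
    rw [gaussianMatrix, Measure.pi_map_pi (f := fun _ (a : Fin n → ℝ) => ∑ j, a j * x₀ j)
      (fun _ => hmeas.aemeasurable), hrow, stdGaussianPi]
  rw [← hmap, Measure.map_apply (by fun_prop) (measurableSet_ringVecEvent m ε β)]
  rfl

/-- Chernoff bound for a sum of functions of i.i.d. standard Gaussian variables. -/
theorem stdGaussianPi_chernoff (m : ℕ) (f : ℝ → ℝ) (a r : ℝ)
    (hfint : Integrable (fun y => Real.exp (f y)) (gaussianReal 0 1))
    (hr : ∫ y, Real.exp (f y) ∂(gaussianReal 0 1) ≤ Real.exp r) :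
    (stdGaussianPi m).real {y | a ≤ ∑ i, f (y i)} ≤ Real.exp (m * r - a) := by
  have hprod : ∀ y : Fin m → ℝ, Real.exp (∑ i, f (y i)) = ∏ i, Real.exp (f (y i)) :=
    fun y => Real.exp_sum _ _
  have hfint' : Integrable (fun y : Fin m → ℝ => Real.exp (∑ i, f (y i))) (stdGaussianPi m) := by
    simp_rw [hprod]
    exact Integrable.fintype_prod (f := fun _ y => Real.exp (f y)) fun _ => hfint
  have hmk := mul_meas_ge_le_integral_of_nonneg (μ := stdGaussianPi m)
    (f := fun y => Real.exp (∑ i, f (y i))) (ae_of_all _ fun y => (Real.exp_pos _).le) hfint'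
    (Real.exp a)
  have hI : ∫ y, Real.exp (∑ i, f (y i)) ∂(stdGaussianPi m) ≤ Real.exp (m * r) := by
    simp_rw [hprod]
    rw [stdGaussianPi, integral_fintype_prod_eq_pow (fun y => Real.exp (f y)), Fintype.card_fin,
      Real.exp_nat_mul]
    exact pow_le_pow_left₀ (integral_nonneg fun y => (Real.exp_pos _).le) hr _
  simp only [Real.exp_le_exp] at hmk
  rw [Real.exp_sub, le_div_iff₀ (Real.exp_pos _), mul_comm]
  exact hmk.trans hI

theorem integral_gaussianReal_eq (f : ℝ → ℝ) :
    ∫ y, f y ∂(gaussianReal 0 1) = (√(2 * π))⁻¹ * ∫ y, Real.exp (-y ^ 2 / 2) * f y := by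
  rw [integral_gaussianReal_eq_integral_smul one_ne_zero, ← integral_const_mul]
  congr 1
  ext y
  simp [gaussianPDFReal, mul_assoc]

theorem integrable_gaussianReal_iff (f : ℝ → ℝ) :
    Integrable f (gaussianReal 0 1) ↔ Integrable fun y => Real.exp (-y ^ 2 / 2) * f y := by
  have hpi : (√(2 * π))⁻¹ ≠ 0 := by positivity
  rw [gaussianReal_of_var_ne_zero _ one_ne_zero, integrable_withDensity_iff_integrable_smul'
    (measurable_gaussianPDF _ _) (ae_of_all _ fun _ => gaussianPDF_lt_top)]
  rw [← integrable_const_mul_iff hpi.isUnit fun y => Real.exp (-y ^ 2 / 2) * f y]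
  refine iff_of_eq (congrArg (Integrable · volume) ?_)
  ext y
  simp [toReal_gaussianPDF, gaussianPDFReal, mul_assoc]

theorem integrable_exp_mul_sq_gaussianReal {l : ℝ} (hl : l < 1 / 2) :
    Integrable (fun y => Real.exp (l * y ^ 2)) (gaussianReal 0 1) := by
  rw [integrable_gaussianReal_iff]
  refine (integrable_exp_neg_mul_sq (b := 1 / 2 - l) (by linarith)).congr (ae_of_all _ fun y => ?_)
  simp only
  rw [← Real.exp_add]
  congr 1; ring

/-- The exponential moments of the square of a standard Gaussian variable. -/
theorem integral_exp_mul_sq_gaussianReal {l : ℝ} (hl : l < 1 / 2) :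
    ∫ y, Real.exp (l * y ^ 2) ∂(gaussianReal 0 1) = (√(1 - 2 * l))⁻¹ := by
  rw [integral_gaussianReal_eq]
  have : ∀ y : ℝ, Real.exp (-y ^ 2 / 2) * Real.exp (l * y ^ 2) =
      Real.exp (-(1 / 2 - l) * y ^ 2) := by
    intro y; rw [← Real.exp_add]; congr 1; ring
  simp_rw [this]
  rw [integral_gaussian, ← Real.sqrt_inv, ← Real.sqrt_mul (by positivity), ← Real.sqrt_inv]
  congr 1
  have : (1 / 2 - l) ≠ 0 := by linarith
  have : (1 - 2 * l) ≠ 0 := by linarith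
  field_simp

theorem one_add_le_exp_sub_sq_add_cube {x : ℝ} (h0 : 0 ≤ x) (h1 : x ≤ 1) :
    1 + x ≤ Real.exp (x - x ^ 2 / 2 + x ^ 3 / 3) := by
  have hu : 0 ≤ x - x ^ 2 / 2 + x ^ 3 / 3 := by nlinarith [pow_nonneg h0 3]
  have h := Real.sum_le_exp_of_nonneg hu 4
  refine le_trans ?_ h
  simp only [Finset.sum_range_succ, Finset.sum_range_zero, Nat.factorial]
  have hpoly : 0 ≤ x ^ 4 * (5 / 24 + x / 8 - 19 / 144 * x ^ 2 + 7 / 72 * x ^ 3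
      - x ^ 4 / 36 + x ^ 5 / 162) := by
    have h2 : x ^ 2 ≤ 1 := pow_le_one₀ h0 h1
    have h3 : x ^ 3 ≤ 1 := pow_le_one₀ h0 h1
    have h4 : 0 ≤ x ^ 4 := by positivity
    have h5 : 0 ≤ x ^ 5 := by positivity
    exact mul_nonneg h4 (by nlinarith)
  norm_num
  linarith

theorem one_sub_le_exp_neg_sub_sq {x : ℝ} (h0 : 0 ≤ x) (h1 : x < 1) :
    1 - x ≤ Real.exp (-x - x ^ 2 / 2) := by
  have hs := hasSum_pow_div_log_of_abs_lt_one (x := x) (by rwa [abs_of_nonneg h0])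
  have h := sum_le_hasSum (Finset.range 2) (fun i _ => by positivity) hs
  simp only [Finset.sum_range_succ, Finset.sum_range_zero] at h
  rw [← Real.log_le_iff_le_exp (by linarith)]
  norm_num at h
  linarith

theorem sqrt_le_exp {x r : ℝ} (h : x ≤ Real.exp (2 * r)) : √x ≤ Real.exp r := by
  refine (Real.sqrt_le_sqrt h).trans_eq ?_
  rw [two_mul, Real.exp_add, Real.sqrt_mul_self (Real.exp_pos _).le]

/-- Upper tail of the chi-squared distribution. -/
theorem stdGaussianPi_upper_tail (m : ℕ) {ε : ℝ} (h0 : 0 < ε) (h1 : ε ≤ 1) :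
    (stdGaussianPi m).real {y | (1 + ε) * m ≤ ∑ i, y i ^ 2} ≤
      Real.exp (-(ε ^ 2 / 4 - ε ^ 3 / 6) * m) := by
  set l : ℝ := ε / (2 * (1 + ε)) with hl
  have hlpos : 0 < l := by positivity
  have hl2 : 1 - 2 * l = (1 + ε)⁻¹ := by rw [hl]; field_simp; ring
  have hlt : l < 1 / 2 := by
    have : 0 < (1 + ε)⁻¹ := by positivity
    linarith
  have h := stdGaussianPi_chernoff m (fun y => l * y ^ 2) (l * ((1 + ε) * m))
    ((ε - ε ^ 2 / 2 + ε ^ 3 / 3) / 2) (integrable_exp_mul_sq_gaussianReal hlt) (by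
      rw [integral_exp_mul_sq_gaussianReal hlt, hl2, Real.sqrt_inv, inv_inv]
      apply sqrt_le_exp
      rw [mul_div_cancel₀ _ two_ne_zero]
      exact one_add_le_exp_sub_sq_add_cube h0.le h1)
  have hset : {y : Fin m → ℝ | l * ((1 + ε) * m) ≤ ∑ i, l * y i ^ 2} =
      {y | (1 + ε) * m ≤ ∑ i, y i ^ 2} := by
    ext y; simp only [Set.mem_ofPred_eq, ← Finset.mul_sum, mul_le_mul_iff_right₀ hlpos]
  rw [hset] at h
  refine h.trans_eq (congrArg Real.exp ?_)
  rw [hl]; field_simp; ring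

/-- Lower tail of the chi-squared distribution. -/
theorem stdGaussianPi_lower_tail (m : ℕ) {ε : ℝ} (h0 : 0 < ε) (h1 : ε < 1) :
    (stdGaussianPi m).real {y | ∑ i, y i ^ 2 ≤ (1 - ε) * m} ≤ Real.exp (-(ε ^ 2 / 4) * m) := by
  have h1' : 0 < 1 - ε := by linarith
  set l : ℝ := ε / (2 * (1 - ε)) with hl
  have hlpos : 0 < l := by positivity
  have hl2 : 1 - 2 * -l = (1 - ε)⁻¹ := by rw [hl]; field_simp; ring
  have hlt : -l < 1 / 2 := by linarith
  have h := stdGaussianPi_chernoff m (fun y => -l * y ^ 2) (-l * ((1 - ε) * m))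
    ((-ε - ε ^ 2 / 2) / 2) (integrable_exp_mul_sq_gaussianReal hlt) (by
      rw [integral_exp_mul_sq_gaussianReal hlt, hl2, Real.sqrt_inv, inv_inv]
      apply sqrt_le_exp
      rw [mul_div_cancel₀ _ two_ne_zero]
      exact one_sub_le_exp_neg_sub_sq h0.le h1)
  have hset : {y : Fin m → ℝ | -l * ((1 - ε) * m) ≤ ∑ i, -l * y i ^ 2} =
      {y | ∑ i, y i ^ 2 ≤ (1 - ε) * m} := by
    ext y
    rw [Set.mem_ofPred_eq, ← Finset.mul_sum, neg_mul, neg_mul, neg_le_neg_iff,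
      mul_le_mul_iff_right₀ hlpos, Set.mem_ofPred_eq]
  rw [hset] at h
  refine h.trans_eq (congrArg Real.exp ?_)
  rw [hl]; field_simp; ring

/-- Tail bound for the total excess of the squares of Gaussian variables over a threshold. -/
theorem stdGaussianPi_excess_tail (m : ℕ) (D β τ : ℝ) (hτ : Real.exp (-(3 / 8 * τ)) = β) :
    (stdGaussianPi m).real {y | (D - β * τ) * m ≤ ∑ i, max (y i ^ 2 - τ) 0} ≤
      Real.exp ((2 * β + 3 / 8 * (β * τ) - 3 / 8 * D) * m) := by
  have hb : (3 / 8 : ℝ) < 1 / 2 := by norm_num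
  have hfint := integrable_exp_mul_sq_gaussianReal hb
  have hle : ∀ y : ℝ, Real.exp (3 / 8 * max (y ^ 2 - τ) 0) ≤ 1 + β * Real.exp (3 / 8 * y ^ 2) := by
    intro y
    rw [← hτ, ← Real.exp_add]
    rcases le_total (y ^ 2 - τ) 0 with h | h
    · rw [max_eq_right h, mul_zero, Real.exp_zero]
      linarith [Real.exp_pos (-(3 / 8 * τ) + 3 / 8 * y ^ 2)]
    · rw [max_eq_left h]
      have : 3 / 8 * (y ^ 2 - τ) = -(3 / 8 * τ) + 3 / 8 * y ^ 2 := by ring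
      rw [this]; linarith
  have hint1 : Integrable (fun y : ℝ => 1 + β * Real.exp (3 / 8 * y ^ 2)) (gaussianReal 0 1) :=
    (integrable_const _).add (hfint.const_mul β)
  have hint2 : Integrable (fun y : ℝ => Real.exp (3 / 8 * max (y ^ 2 - τ) 0))
      (gaussianReal 0 1) := by
    refine hint1.mono' (by fun_prop) (ae_of_all _ fun y => ?_)
    rw [Real.norm_of_nonneg (Real.exp_pos _).le]
    exact hle y
  have h := stdGaussianPi_chernoff m (fun y => 3 / 8 * max (y ^ 2 - τ) 0)
    (3 / 8 * ((D - β * τ) * m)) (2 * β) hint2 (by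
      refine (integral_mono hint2 hint1 hle).trans ?_
      rw [integral_add (integrable_const _) (hfint.const_mul β), integral_const_mul,
        integral_exp_mul_sq_gaussianReal hb]
      have : √(1 - 2 * (3 / 8 : ℝ)) = 1 / 2 := by
        rw [show (1 - 2 * (3 / 8 : ℝ)) = (1 / 2) ^ 2 by norm_num]
        exact Real.sqrt_sq (by norm_num)
      rw [this]
      have h2 := Real.add_one_le_exp (2 * β)
      simp only [integral_const, probReal_univ, smul_eq_mul, mul_one]
      linarith)
  have hset : {y : Fin m → ℝ | 3 / 8 * ((D - β * τ) * m) ≤ ∑ i, 3 / 8 * max (y i ^ 2 - τ) 0} =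
      {y | (D - β * τ) * m ≤ ∑ i, max (y i ^ 2 - τ) 0} := by
    ext y
    simp only [Set.mem_ofPred_eq, ← Finset.mul_sum,
      mul_le_mul_iff_right₀ (show (0 : ℝ) < 3 / 8 by norm_num)]
  rw [hset] at h
  refine h.trans_eq (congrArg Real.exp ?_)
  ring

theorem mem_ringVecEvent {m : ℕ} (hm : 0 < m) {ε D β τ : ℝ} (hτ : 0 ≤ τ) {y : Fin m → ℝ}
    (h1 : ∑ i, y i ^ 2 < (1 + ε) * m) (h2 : (1 - (ε - D)) * m < ∑ i, y i ^ 2)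
    (h3 : ∑ i, max (y i ^ 2 - τ) 0 < (D - β * τ) * m) : y ∈ ringVecEvent m ε β := by
  intro T hT
  have hm' : (0 : ℝ) < m := by exact_mod_cast hm
  have hle : ∑ i ∈ T, y i ^ 2 ≤ ∑ i, y i ^ 2 :=
    Finset.sum_le_univ_sum_of_nonneg fun i => sq_nonneg _
  have hsplit : ∑ i ∈ T, y i ^ 2 + ∑ i ∈ Tᶜ, y i ^ 2 = ∑ i, y i ^ 2 :=
    Finset.sum_add_sum_compl T _
  have hc : ∑ i ∈ Tᶜ, y i ^ 2 ≤ Tᶜ.card * τ + ∑ i, max (y i ^ 2 - τ) 0 := by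
    calc ∑ i ∈ Tᶜ, y i ^ 2 ≤ ∑ i ∈ Tᶜ, (τ + max (y i ^ 2 - τ) 0) :=
          Finset.sum_le_sum fun i _ => by
            linarith [le_max_left (y i ^ 2 - τ) (0 : ℝ)]
      _ = Tᶜ.card * τ + ∑ i ∈ Tᶜ, max (y i ^ 2 - τ) 0 := by
          rw [Finset.sum_add_distrib, Finset.sum_const, nsmul_eq_mul]
      _ ≤ _ := by
          exact add_le_add le_rfl
            (Finset.sum_le_univ_sum_of_nonneg fun i => le_max_right (y i ^ 2 - τ) (0 : ℝ))
  have hcard := mul_le_mul_of_nonneg_right hT hτ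
  rw [abs_le, one_div, inv_mul_eq_div]
  constructor
  · rw [neg_le_sub_iff_le_add, ← sub_le_iff_le_add, le_div_iff₀ hm']
    nlinarith
  · rw [sub_le_iff_le_add, div_le_iff₀ hm']
    nlinarith

theorem one_sub_le_stdGaussianPi_ringVecEvent {m : ℕ} (hm : 0 < m) {α ε β : ℝ}
    (hα0 : 0 < α) (hα1 : α < 1) (hε0 : 0 < ε) (hε1 : ε ≤ 1) (hβ0 : 0 < β) (hβ1 : β < 1)
    (hβ : β * (2 + Real.log (1 / β)) ≤ 3 / 8 * ((1 - √α) * ε) - α * (ε ^ 2 / 4 - ε ^ 3 / 6)) :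
    ENNReal.ofReal (1 - 3 * Real.exp (-α * (ε ^ 2 / 4 - ε ^ 3 / 6) * m)) ≤
      stdGaussianPi m (ringVecEvent m ε β) := by
  have hs0 : 0 < √α := Real.sqrt_pos.2 hα0
  have hs1 : √α < 1 := by
    rw [Real.sqrt_lt' one_pos]; simpa using hα1
  have hs2 : √α ^ 2 = α := Real.sq_sqrt hα0.le
  set D := (1 - √α) * ε with hD
  set τ := 8 / 3 * Real.log (1 / β) with hτdef
  have hlog : 0 < Real.log (1 / β) := Real.log_pos (by rw [lt_div_iff₀ hβ0]; linarith)
  have hτ0 : 0 ≤ τ := by positivity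
  have hτ : Real.exp (-(3 / 8 * τ)) = β := by
    rw [hτdef, one_div, Real.log_inv]
    rw [show -(3 / 8 * (8 / 3 * -Real.log β)) = Real.log β by ring, Real.exp_log hβ0]
  set E := Real.exp (-α * (ε ^ 2 / 4 - ε ^ 3 / 6) * m)
  have hψ : 0 ≤ ε ^ 2 / 4 - ε ^ 3 / 6 := by nlinarith [sq_nonneg ε]
  have hm' : (0 : ℝ) < m := by exact_mod_cast hm
  have b1 : (stdGaussianPi m).real {y | (1 + ε) * m ≤ ∑ i, y i ^ 2} ≤ E := by
    refine (stdGaussianPi_upper_tail m hε0 hε1).trans (Real.exp_le_exp.2 ?_)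
    gcongr
    nlinarith
  have b2 : (stdGaussianPi m).real {y | ∑ i, y i ^ 2 ≤ (1 - √α * ε) * m} ≤ E := by
    refine (stdGaussianPi_lower_tail m (mul_pos hs0 hε0) (by nlinarith)).trans
      (Real.exp_le_exp.2 ?_)
    gcongr
    rw [mul_pow, hs2]
    nlinarith [pow_pos hε0 3, mul_pos hα0 (pow_pos hε0 3)]
  have b3 : (stdGaussianPi m).real {y | (D - β * τ) * m ≤ ∑ i, max (y i ^ 2 - τ) 0} ≤ E := by
    refine (stdGaussianPi_excess_tail m D β τ hτ).trans (Real.exp_le_exp.2 ?_)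
    gcongr
    rw [hτdef]
    linarith
  have hsub : (ringVecEvent m ε β)ᶜ ⊆ ({y | (1 + ε) * m ≤ ∑ i, y i ^ 2} ∪
      {y | ∑ i, y i ^ 2 ≤ (1 - √α * ε) * m}) ∪
      {y | (D - β * τ) * m ≤ ∑ i, max (y i ^ 2 - τ) 0} := by
    intro y hy
    by_contra hn
    simp only [Set.mem_union, Set.mem_ofPred_eq, not_or, not_le] at hn
    refine hy (mem_ringVecEvent hm hτ0 hn.1.1 ?_ hn.2)
    have : ε - D = √α * ε := by rw [hD]; ring
    rw [this]; exact hn.1.2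
  have hcompl : (stdGaussianPi m).real (ringVecEvent m ε β)ᶜ ≤ 3 * E := by
    refine (measureReal_mono hsub).trans ((measureReal_union_le _ _).trans ?_)
    linarith [measureReal_union_le (μ := stdGaussianPi m) {y | (1 + ε) * m ≤ ∑ i, y i ^ 2}
      {y | ∑ i, y i ^ 2 ≤ (1 - √α * ε) * m}]
  rw [probReal_compl_eq_one_sub (measurableSet_ringVecEvent m ε β)] at hcompl
  rw [← ofReal_measureReal]
  exact ENNReal.ofReal_le_ofReal (by linarith)

/-- Large deviations for the number of coordinates lying in a set. -/
theorem stdGaussianPi_count_tail (m : ℕ) {S : Set ℝ} (hS : MeasurableSet S) {b : ℝ}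
    (hb : (gaussianReal 0 1).real S ≤ b) (hb1 : b ≤ 1) :
    (stdGaussianPi m).real {y | b * m ≤ ∑ i, S.indicator 1 (y i)} ≤
      Real.exp (-((b - (gaussianReal 0 1).real S) ^ 2 / 4) * m) := by
  set p := (gaussianReal 0 1).real S with hp
  have hp0 : 0 ≤ p := measureReal_nonneg
  rcases hb.eq_or_lt with hb | hb
  · simp only [hb, sub_self]
    norm_num
  set l := (b - p) / 2 with hl
  have hl0 : 0 < l := by rw [hl]; linarith
  have hl1 : l ≤ 1 := by rw [hl]; linarith
  have hexp : ∀ y, Real.exp (l * S.indicator 1 y) = 1 + (Real.exp l - 1) * S.indicator 1 y := by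
    intro y
    by_cases hy : y ∈ S <;> simp [hy]
  have hind : Integrable (S.indicator (1 : ℝ → ℝ)) (gaussianReal 0 1) :=
    (integrable_const (1 : ℝ)).indicator hS
  have h := stdGaussianPi_chernoff m (fun y => l * S.indicator 1 y) (l * (b * m))
    (p * (l + l ^ 2)) (by
      simp_rw [hexp]
      exact (integrable_const _).add (hind.const_mul _)) (by
      simp_rw [hexp]
      rw [integral_add (integrable_const _) (hind.const_mul _), integral_const_mul,
        integral_indicator_one hS, ← hp]
      simp only [integral_const, probReal_univ, smul_eq_mul, mul_one]
      have h1 := Real.abs_exp_sub_one_sub_id_le (x := l) (by rwa [abs_of_pos hl0])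
      have h2 := (abs_le.1 h1).2
      have h3 := Real.add_one_le_exp (p * (l + l ^ 2))
      nlinarith)
  have hset : {y : Fin m → ℝ | l * (b * m) ≤ ∑ i, l * S.indicator (1 : ℝ → ℝ) (y i)} =
      {y | b * m ≤ ∑ i, S.indicator (1 : ℝ → ℝ) (y i)} := by
    ext y
    rw [Set.mem_ofPred_eq, ← Finset.mul_sum, mul_le_mul_iff_right₀ hl0, Set.mem_ofPred_eq]
  rw [hset] at h
  refine h.trans (Real.exp_le_exp.2 ?_)
  have hp1 : p ≤ 1 := by linarith
  have : m * (p * (l + l ^ 2)) - l * (b * m) ≤ (l ^ 2 - l * (b - p)) * m := by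
    have : (0 : ℝ) ≤ m := m.cast_nonneg
    nlinarith [mul_nonneg (mul_nonneg (sub_nonneg.2 hp1) (sq_nonneg l)) this]
  refine this.trans_eq ?_
  rw [hl]; ring

/-- The expectation of the sum of a function of the coordinates of a Gaussian vector. -/
theorem integral_stdGaussianPi_sum (m : ℕ) (f : ℝ → ℝ) (hf : Integrable f (gaussianReal 0 1)) :
    Integrable (fun y => ∑ i, f (y i)) (stdGaussianPi m) ∧
    ∫ y, ∑ i, f (y i) ∂(stdGaussianPi m) = m * ∫ y, f y ∂(gaussianReal 0 1) := by
  have hmp : ∀ i : Fin m, MeasurePreserving (fun y : Fin m → ℝ => y i) (stdGaussianPi m)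
      (gaussianReal 0 1) := fun i => measurePreserving_eval (fun _ : Fin m => gaussianReal 0 1) i
  have hfint : ∀ i : Fin m, Integrable (fun y : Fin m → ℝ => f (y i)) (stdGaussianPi m) :=
    fun i => (hmp i).integrable_comp_of_integrable hf
  refine ⟨integrable_finsetSum _ fun i _ => hfint i, ?_⟩
  rw [integral_finsetSum _ fun i _ => hfint i]
  have : ∀ i : Fin m, ∫ y, f (y i) ∂(stdGaussianPi m) = ∫ y, f y ∂(gaussianReal 0 1) := by
    intro i
    rw [← (hmp i).map_eq, integral_map (hmp i).aemeasurable]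
    rw [(hmp i).map_eq]
    exact hf.aestronglyMeasurable
  simp [this]

theorem integrable_sq_gaussianReal : Integrable (fun y : ℝ => y ^ 2) (gaussianReal 0 1) := by
  have h := (memLp_id_gaussianReal (μ := 0) (v := 1) 2).integrable_sq
  simpa using h

theorem integral_sq_gaussianReal : ∫ y, y ^ 2 ∂(gaussianReal 0 1) = 1 := by
  have h := variance_fun_id_gaussianReal (μ := 0) (v := 1)
  rw [variance_of_integral_eq_zero (by fun_prop) (by simp)] at h
  simpa using h

theorem tendsto_exp_neg_mul_natCast {a : ℝ} (ha : 0 < a) :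
    Filter.Tendsto (fun m : ℕ => Real.exp (-a * m)) Filter.atTop (nhds 0) := by
  refine Real.tendsto_exp_atBot.comp ?_
  exact Filter.Tendsto.const_mul_atTop_of_neg (by linarith) tendsto_natCast_atTop_atTop

/-- If the event `Ω̊_{ε,β}` is likely in all dimensions and `β` exceeds the probability of a set
`S`, then discarding the coordinates in `S` costs at most `ε` of the second moment. -/
theorem one_sub_le_integral_indicator_compl_sq {S : Set ℝ} (hS : MeasurableSet S) {ε β κ : ℝ}
    (hε : ε < 1) (hβ : (gaussianReal 0 1).real S < β) (hβ1 : β < 1) (hκ : 0 < κ)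
    (h : ∀ m : ℕ, 0 < m → ENNReal.ofReal (1 - 3 * Real.exp (-κ * m)) ≤
      stdGaussianPi m (ringVecEvent m ε β)) :
    1 - ε ≤ ∫ y, Sᶜ.indicator (fun y => y ^ 2) y ∂(gaussianReal 0 1) := by
  set p := (gaussianReal 0 1).real S
  set q := ∫ y, Sᶜ.indicator (fun y => y ^ 2) y ∂(gaussianReal 0 1)
  set κ' := (β - p) ^ 2 / 4
  have hκ' : 0 < κ' := by
    have : 0 < β - p := by linarith
    positivity
  have key : ∀ m : ℕ, 0 < m →
      (1 - ε) * (1 - 3 * Real.exp (-κ * m) - Real.exp (-κ' * m)) ≤ q := by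
    intro m hm
    have hm' : (0 : ℝ) < m := by exact_mod_cast hm
    set B := {y : Fin m → ℝ | β * m ≤ ∑ i, S.indicator (1 : ℝ → ℝ) (y i)} with hB
    have hΩ : 1 - 3 * Real.exp (-κ * m) ≤ (stdGaussianPi m).real (ringVecEvent m ε β) := by
      rw [measureReal_def]
      exact (ENNReal.ofReal_le_iff_le_toReal (measure_ne_top _ _)).1 (h m hm)
    have hBm := stdGaussianPi_count_tail m hS hβ.le hβ1.le
    obtain ⟨hfint, hval⟩ := integral_stdGaussianPi_sum m (Sᶜ.indicator fun y => y ^ 2)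
      (integrable_sq_gaussianReal.indicator hS.compl)
    have hnn : ∀ y, 0 ≤ Sᶜ.indicator (fun y : ℝ => y ^ 2) y :=
      Set.indicator_nonneg fun y _ => sq_nonneg y
    have hmk := mul_meas_ge_le_integral_of_nonneg
      (ae_of_all _ fun y => Finset.sum_nonneg fun i _ => hnn (y i)) hfint ((1 - ε) * m)
    rw [hval] at hmk
    have hsub : ringVecEvent m ε β ⊆
        {y | (1 - ε) * m ≤ ∑ i, Sᶜ.indicator (fun y => y ^ 2) (y i)} ∪ B := by
      intro y hy
      by_cases hyB : y ∈ B
      · exact Or.inr hyB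
      left
      classical
      set T : Finset (Fin m) := Finset.univ.filter fun i => y i ∈ Sᶜ with hT
      have hTc : (Tᶜ.card : ℝ) = ∑ i, S.indicator (1 : ℝ → ℝ) (y i) := by
        rw [hT, Finset.compl_filter]
        simp [Set.indicator_apply]
      have hle : (Tᶜ.card : ℝ) ≤ β * m := by
        rw [hTc]
        exact (not_le.1 hyB).le
      have hy' := (abs_le.1 (hy T hle)).1
      have hTs : ∑ i ∈ T, y i ^ 2 = ∑ i, Sᶜ.indicator (fun y => y ^ 2) (y i) := by
        rw [hT, Finset.sum_filter]
        simp only [Set.indicator_apply]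
      rw [hTs, one_div, inv_mul_eq_div, neg_le_sub_iff_le_add, ← sub_le_iff_le_add,
        le_div_iff₀ hm'] at hy'
      exact hy'
    have hP : 1 - 3 * Real.exp (-κ * m) - Real.exp (-κ' * m) ≤
        (stdGaussianPi m).real {y | (1 - ε) * m ≤ ∑ i, Sᶜ.indicator (fun y => y ^ 2) (y i)} := by
      have := (measureReal_mono (μ := stdGaussianPi m) hsub).trans (measureReal_union_le _ _)
      linarith
    have := mul_le_mul_of_nonneg_left hP (show 0 ≤ (1 - ε) * m by nlinarith)
    have h3 := this.trans hmk
    rw [mul_right_comm, mul_comm (m : ℝ) q] at h3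
    exact le_of_mul_le_mul_right h3 hm'
  have hlim : Filter.Tendsto
      (fun m : ℕ => (1 - ε) * (1 - 3 * Real.exp (-κ * m) - Real.exp (-κ' * m)))
      Filter.atTop (nhds ((1 - ε) * (1 - 3 * 0 - 0))) :=
    (((tendsto_exp_neg_mul_natCast hκ).const_mul 3).const_sub 1 |>.sub
      (tendsto_exp_neg_mul_natCast hκ')).const_mul (1 - ε)
  have := le_of_tendsto hlim (Filter.eventually_atTop.2 ⟨1, fun m hm => key m hm⟩)
  linarith

theorem compl_setOf_lt_abs (t : ℝ) : {y : ℝ | t < |y|}ᶜ = Set.Icc (-t) t := by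
  ext y
  simp [abs_le]

theorem measurableSet_setOf_lt_abs (t : ℝ) : MeasurableSet {y : ℝ | t < |y|} :=
  measurableSet_lt measurable_const (by fun_prop)

theorem integral_indicator_Icc_gaussianReal {t : ℝ} (ht : 0 ≤ t) (f : ℝ → ℝ) :
    ∫ y, (Set.Icc (-t) t).indicator f y ∂(gaussianReal 0 1) =
      (√(2 * π))⁻¹ * ∫ y in (-t)..t, Real.exp (-y ^ 2 / 2) * f y := by
  rw [integral_gaussianReal_eq, intervalIntegral.integral_of_le (by linarith),
    ← integral_Icc_eq_integral_Ioc, ← integral_indicator measurableSet_Icc]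
  congr 2
  ext y
  by_cases hy : y ∈ Set.Icc (-t) t <;> simp [hy]

theorem integral_indicator_Icc_one_gaussianReal (t : ℝ) :
    ∫ y, (Set.Icc (-t) t).indicator (fun _ => (1 : ℝ)) y ∂(gaussianReal 0 1) =
      1 - (gaussianReal 0 1).real {y | t < |y|} := by
  rw [← probReal_compl_eq_one_sub (measurableSet_setOf_lt_abs t), compl_setOf_lt_abs]
  exact integral_indicator_one measurableSet_Icc

theorem hasDerivAt_exp_neg_sq_half (y : ℝ) :
    HasDerivAt (fun y => Real.exp (-y ^ 2 / 2)) (Real.exp (-y ^ 2 / 2) * -y) y := by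
  have h : HasDerivAt (fun y : ℝ => -y ^ 2 / 2) (-y) y := by
    convert! ((hasDerivAt_pow 2 y).neg).div_const 2 using 1
    simp
    ring
  exact h.exp

/-- The truncated second moment of a standard Gaussian variable. -/
theorem integral_indicator_compl_sq_gaussianReal {t : ℝ} (ht : 0 ≤ t) :
    ∫ y, {y : ℝ | t < |y|}ᶜ.indicator (fun y => y ^ 2) y ∂(gaussianReal 0 1) =
      1 - (gaussianReal 0 1).real {y | t < |y|} -
        2 * t * ((√(2 * π))⁻¹ * Real.exp (-t ^ 2 / 2)) := by
  rw [compl_setOf_lt_abs, ← integral_indicator_Icc_one_gaussianReal,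
    integral_indicator_Icc_gaussianReal ht, integral_indicator_Icc_gaussianReal ht]
  have hF : ∫ y in (-t)..t, Real.exp (-y ^ 2 / 2) * (y ^ 2 - 1) =
      -(2 * t * Real.exp (-t ^ 2 / 2)) := by
    rw [intervalIntegral.integral_eq_sub_of_hasDerivAt
      (f := fun y => -y * Real.exp (-y ^ 2 / 2))]
    · simp; ring
    · intro y _
      convert! ((hasDerivAt_id y).neg).mul (hasDerivAt_exp_neg_sq_half y) using 1
      simp; ring
    · exact (by fun_prop : Continuous fun y : ℝ => Real.exp (-y ^ 2 / 2) *
        (y ^ 2 - 1)).intervalIntegrable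
        _ _
  have hsub : ∫ y in (-t)..t, Real.exp (-y ^ 2 / 2) * (y ^ 2 - 1) =
      (∫ y in (-t)..t, Real.exp (-y ^ 2 / 2) * y ^ 2) -
        ∫ y in (-t)..t, Real.exp (-y ^ 2 / 2) * 1 := by
    rw [← intervalIntegral.integral_sub]
    · congr 1; ext y; ring
    · exact (by fun_prop : Continuous fun y : ℝ => Real.exp (-y ^ 2 / 2) * y ^ 2).intervalIntegrable
        _ _
    · exact (by fun_prop : Continuous fun y : ℝ => Real.exp (-y ^ 2 / 2) * 1).intervalIntegrable
        _ _
  have : (∫ y in (-t)..t, Real.exp (-y ^ 2 / 2) * y ^ 2) =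
      (∫ y in (-t)..t, Real.exp (-y ^ 2 / 2) * 1) - 2 * t * Real.exp (-t ^ 2 / 2) := by linarith
  rw [this]; ring

theorem tendsto_exp_neg_sq_half :
    Filter.Tendsto (fun y : ℝ => Real.exp (-y ^ 2 / 2)) Filter.atTop (nhds 0) := by
  refine Real.tendsto_exp_atBot.comp ?_
  have h : Filter.Tendsto (fun y : ℝ => (-1 / 2) * y ^ 2) Filter.atTop Filter.atBot :=
    Filter.Tendsto.const_mul_atTop_of_neg (by norm_num)
      (Filter.tendsto_pow_atTop two_ne_zero)
  exact h.congr fun y => by ring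

/-- The two-sided Gaussian tail bound (Mills ratio). -/
theorem gaussianReal_real_lt_abs_le {t : ℝ} (ht : 0 < t) :
    (gaussianReal 0 1).real {y | t < |y|} ≤
      2 * ((√(2 * π))⁻¹ * Real.exp (-t ^ 2 / 2)) / t := by
  have hS := measurableSet_setOf_lt_abs t
  have habs : Integrable (fun y : ℝ => |y| / t) (gaussianReal 0 1) := by
    have h := (memLp_id_gaussianReal (μ := 0) (v := 1) 1).integrable (by norm_num)
    exact h.abs.div_const t
  rw [← integral_indicator_one hS]
  calc ∫ y, {y : ℝ | t < |y|}.indicator 1 y ∂(gaussianReal 0 1)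
      ≤ ∫ y, {y : ℝ | t < |y|}.indicator (fun y => |y| / t) y ∂(gaussianReal 0 1) := by
        refine integral_mono ((integrable_const (1 : ℝ)).indicator hS) (habs.indicator hS)
          fun y => ?_
        refine Set.indicator_le_indicator' fun hy => ?_
        rw [Pi.one_apply, one_le_div ht]
        exact le_of_lt hy
    _ = (√(2 * π))⁻¹ * ∫ y : ℝ, (fun x => (Set.Ioi t).indicator
          (fun x => Real.exp (-x ^ 2 / 2) * x / t) x) |y| := by
        rw [integral_gaussianReal_eq]
        congr 2
        ext y
        by_cases hy : t < |y|
        · simp [hy, mul_div_assoc]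
        · simp [hy]
    _ = _ := by
        have hd : ∀ x ∈ Set.Ici t, HasDerivAt (fun x => -Real.exp (-x ^ 2 / 2) / t)
            (Real.exp (-x ^ 2 / 2) * x / t) x := by
          intro x _
          convert! ((hasDerivAt_exp_neg_sq_half x).neg).div_const t using 1
          ring
        have hlim : Filter.Tendsto (fun x => -Real.exp (-x ^ 2 / 2) / t) Filter.atTop (nhds 0) := by
          simpa using tendsto_exp_neg_sq_half.neg.div_const t
        have hpos : ∀ x ∈ Set.Ioi t, 0 ≤ Real.exp (-x ^ 2 / 2) * x / t := by
          intro x hx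
          have : 0 < x := ht.trans hx
          positivity
        rw [integral_comp_abs, setIntegral_indicator measurableSet_Ioi,
          Set.inter_eq_self_of_subset_right (Set.Ioi_subset_Ioi ht.le),
          integral_Ioi_of_hasDerivAt_of_nonneg' hd hpos hlim]
        ring

theorem gaussianReal_real_lt_abs_pos (t : ℝ) : 0 < (gaussianReal 0 1).real {y | t < |y|} := by
  rw [measureReal_def, ENNReal.toReal_pos_iff]
  refine ⟨pos_iff_ne_zero.2 fun h => ?_, measure_lt_top _ _⟩
  have h0 := gaussianReal_absolutelyContinuous' 0 one_ne_zero h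
  have h1 : volume (Set.Ioi t) = 0 :=
    measure_mono_null (fun y hy => lt_of_lt_of_le hy (le_abs_self y)) h0
  simp at h1

theorem gaussianReal_real_lt_abs_lt_half :
    (gaussianReal 0 1).real {y | (4 / 5 : ℝ) < |y|} < 1 / 2 := by
  have h := integral_indicator_Icc_one_gaussianReal (4 / 5)
  rw [integral_indicator_Icc_gaussianReal (by norm_num)] at h
  have hle : ∫ y in (-(4 / 5 : ℝ))..(4 / 5), (1 - y ^ 2 / 2) ≤
      ∫ y in (-(4 / 5 : ℝ))..(4 / 5), Real.exp (-y ^ 2 / 2) * 1 := by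
    refine intervalIntegral.integral_mono_on (by norm_num)
      ((by fun_prop : Continuous fun y : ℝ => 1 - y ^ 2 / 2).intervalIntegrable _ _)
      ((by fun_prop : Continuous fun y : ℝ => Real.exp (-y ^ 2 / 2) * 1).intervalIntegrable _ _)
      fun y _ => ?_
    have := Real.add_one_le_exp (-y ^ 2 / 2)
    linarith
  have hval : ∫ y in (-(4 / 5 : ℝ))..(4 / 5), (1 - y ^ 2 / 2) = 536 / 375 := by
    rw [intervalIntegral.integral_sub (by simp) (by
      exact (by fun_prop : Continuous fun y : ℝ => y ^ 2 / 2).intervalIntegrable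
        _ _)]
    simp [intervalIntegral.integral_div]
    norm_num
  have hsqrt : √(2 * π) < 251 / 100 := by
    rw [Real.sqrt_lt' (by norm_num)]
    nlinarith [Real.pi_lt_d4]
  have hpos : 0 < √(2 * π) := by positivity
  have hinv : (100 / 251 : ℝ) < (√(2 * π))⁻¹ := by
    rw [lt_inv_comm₀ (by norm_num) hpos]
    refine hsqrt.trans_eq ?_
    norm_num
  nlinarith

theorem succ_mul_le_sum_of_absOrd {m : ℕ} (y : Fin m → ℝ) (j : Fin m) (g : ℝ → ℝ)
    (hg0 : ∀ x, 0 ≤ g x) (hg : MonotoneOn g (Set.Ici 0)) :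
    ((j : ℕ) + 1 : ℝ) * g (absOrd y j) ≤ ∑ i, g |y i| := by
  set σ := Tuple.sort fun i => -|y i| with hσ
  have hmono := Tuple.monotone_sort fun i => -|y i|
  calc ((j : ℕ) + 1 : ℝ) * g (absOrd y j) = ∑ _i ∈ Finset.Iic j, g (absOrd y j) := by
        rw [Finset.sum_const, Fin.card_Iic, nsmul_eq_mul]; push_cast; ring
    _ ≤ ∑ i ∈ Finset.Iic j, g |y (σ i)| := by
        refine Finset.sum_le_sum fun i hi =>
          hg (Set.mem_Ici.2 (abs_nonneg (y (σ j)))) (Set.mem_Ici.2 (abs_nonneg (y (σ i)))) ?_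
        have := hmono (Finset.mem_Iic.1 hi)
        simp only [Function.comp_apply, neg_le_neg_iff] at this
        exact this
    _ ≤ ∑ i, g |y (σ i)| := Finset.sum_le_univ_sum_of_nonneg fun i => hg0 _
    _ = ∑ i, g |y i| := Equiv.sum_comp σ fun i => g |y i|

theorem absOrd_le {m : ℕ} (y : Fin m → ℝ) (j : Fin m) (s : ℝ) (hs : 0 ≤ s) :
    absOrd y j ≤ s + 1 / 100 * ((∑ i, y i ^ 2) / ((j : ℕ) + 1)) + 25 *
      {y : Fin m → ℝ | ((j : ℕ) + 1 : ℝ) ≤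
        ∑ i, {x : ℝ | s < |x|}.indicator (1 : ℝ → ℝ) (y i)}.indicator 1 y := by
  have hj : (0 : ℝ) < (j : ℕ) + 1 := by positivity
  have hsq : absOrd y j ^ 2 ≤ (∑ i, y i ^ 2) / ((j : ℕ) + 1) := by
    rw [le_div_iff₀' hj]
    refine (succ_mul_le_sum_of_absOrd y j (fun x => x ^ 2) (fun x => sq_nonneg x)
      fun a ha b _ hab => pow_le_pow_left₀ ha hab 2).trans_eq ?_
    simp
  rcases le_or_gt (absOrd y j) s with h | h
  · have h1 : (0 : ℝ) ≤ {y : Fin m → ℝ | ((j : ℕ) + 1 : ℝ) ≤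
        ∑ i, {x : ℝ | s < |x|}.indicator (1 : ℝ → ℝ) (y i)}.indicator 1 y :=
      Set.indicator_nonneg (fun _ _ => zero_le_one) _
    nlinarith [sq_nonneg (absOrd y j)]
  · have hmem : y ∈ {y : Fin m → ℝ | ((j : ℕ) + 1 : ℝ) ≤
        ∑ i, {x : ℝ | s < |x|}.indicator (1 : ℝ → ℝ) (y i)} := by
      have := succ_mul_le_sum_of_absOrd y j ((Set.Ioi s).indicator 1)
        (Set.indicator_nonneg fun _ _ => zero_le_one) (by
          intro a _ b _ hab
          by_cases ha : s < a
          · simp [ha, ha.trans_le hab]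
          · simp only [Set.indicator_of_notMem (show a ∉ Set.Ioi s from ha)]
            exact Set.indicator_nonneg (fun _ _ => zero_le_one) b)
      rw [Set.indicator_of_mem (Set.mem_Ioi.2 h), Pi.one_apply, mul_one] at this
      exact this
    rw [Set.indicator_of_mem hmem, Pi.one_apply]
    nlinarith [sq_nonneg (absOrd y j - 50)]

/-- Any constant with the order-statistics property satisfies `c² ≤ 1/2`. -/
theorem sq_le_half_of_cgProperty {c : ℝ} (hc : 0 < c) (h : cgProperty c) : c ^ 2 ≤ 1 / 2 := by
  set S : Set ℝ := {x | (4 / 5 : ℝ) < |x|} with hSdef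
  have hS : MeasurableSet S := measurableSet_setOf_lt_abs _
  set p := (gaussianReal 0 1).real S with hp
  have hp2 : p < 1 / 2 := gaussianReal_real_lt_abs_lt_half
  set κ := (1 / 2 - p) ^ 2 / 4
  have hκ : 0 < κ := by
    have : 0 < 1 / 2 - p := by linarith
    positivity
  have key : ∀ k : ℕ, 0 < k →
      c * √(Real.log 4) ≤ 4 / 5 + 1 / 50 + 25 * Real.exp (-(2 * κ) * k) := by
    intro k hk
    set j : Fin (2 * k) := ⟨k - 1, by omega⟩ with hj
    have hjk : ((j : ℕ) : ℝ) + 1 = k := by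
      have : (j : ℕ) + 1 = k := by simp [hj]; omega
      exact_mod_cast this
    have hk' : (0 : ℝ) < k := by exact_mod_cast hk
    have h1 := h (2 * k) j (by simp [hj]; omega)
    rw [hjk] at h1
    have h4 : (2 * ((2 * k : ℕ) : ℝ) / k) = 4 := by push_cast; field_simp; norm_num
    rw [h4] at h1
    refine h1.trans ?_
    set B := {y : Fin (2 * k) → ℝ | (1 / 2 : ℝ) * (2 * k : ℕ) ≤
      ∑ i, S.indicator (1 : ℝ → ℝ) (y i)} with hB
    have hBm : MeasurableSet B := by
      refine measurableSet_le measurable_const (Finset.measurable_sum _ fun i _ => ?_)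
      exact (measurable_one.indicator hS).comp (measurable_pi_apply i)
    have hBP : (stdGaussianPi (2 * k)).real B ≤ Real.exp (-κ * (2 * k : ℕ)) :=
      stdGaussianPi_count_tail (2 * k) hS hp2.le (by norm_num)
    have hBk : B = {y : Fin (2 * k) → ℝ | ((j : ℕ) + 1 : ℝ) ≤
        ∑ i, S.indicator (1 : ℝ → ℝ) (y i)} := by
      rw [hB, hjk]; push_cast; ring_nf
    obtain ⟨hfint, hval⟩ := integral_stdGaussianPi_sum (2 * k) _ integrable_sq_gaussianReal
    have hi1 : Integrable (fun y : Fin (2 * k) → ℝ =>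
        4 / 5 + 1 / 100 * ((∑ i, y i ^ 2) / ((j : ℕ) + 1))) (stdGaussianPi (2 * k)) :=
      (integrable_const _).add ((hfint.div_const _).const_mul _)
    have hi2 : Integrable (B.indicator (1 : (Fin (2 * k) → ℝ) → ℝ)) (stdGaussianPi (2 * k)) :=
      (integrable_const (1 : ℝ)).indicator hBm
    calc ∫ y, absOrd y j ∂(stdGaussianPi (2 * k))
        ≤ ∫ y, (4 / 5 + 1 / 100 * ((∑ i, y i ^ 2) / ((j : ℕ) + 1)) + 25 * B.indicator 1 y)
            ∂(stdGaussianPi (2 * k)) := by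
          refine integral_mono_of_nonneg (ae_of_all _ fun y => abs_nonneg _)
            (hi1.add (hi2.const_mul 25)) (ae_of_all _ fun y => ?_)
          simp only [hBk]
          exact absOrd_le y j (4 / 5) (by norm_num)
      _ = 4 / 5 + 1 / 50 + 25 * (stdGaussianPi (2 * k)).real B := by
          rw [integral_add hi1 (hi2.const_mul 25),
            integral_add (integrable_const _) ((hfint.div_const _).const_mul _),
            integral_const, probReal_univ, one_smul, integral_const_mul, integral_const_mul,
            integral_div, hval, integral_sq_gaussianReal, integral_indicator_one hBm, hjk]
          push_cast
          field_simp
          ring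
      _ ≤ _ := by
          have : -κ * (2 * k : ℕ) = -(2 * κ) * k := by push_cast; ring
          rw [this] at hBP
          linarith
  have hlim : Filter.Tendsto (fun k : ℕ => 4 / 5 + 1 / 50 + 25 * Real.exp (-(2 * κ) * k))
      Filter.atTop (nhds (4 / 5 + 1 / 50 + 25 * 0)) :=
    ((tendsto_exp_neg_mul_natCast (by positivity)).const_mul 25).const_add _
  have hfin := ge_of_tendsto hlim (Filter.eventually_atTop.2 ⟨1, key⟩)
  have hlog4 : (138 / 100 : ℝ) < Real.log 4 := by
    rw [show (4 : ℝ) = 2 ^ 2 by norm_num, Real.log_pow]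
    have := Real.log_two_gt_d9
    push_cast; linarith
  have hsq := Real.sq_sqrt (show (0 : ℝ) ≤ Real.log 4 by linarith)
  have h2 := pow_le_pow_left₀ (by positivity) hfin 2
  rw [mul_pow, hsq] at h2
  nlinarith [sq_nonneg c]

theorem exists_two_mul_gaussian_eq {ε : ℝ} (h0 : 0 < ε) (h1 : ε < 1 / 4) :
    ∃ t : ℝ, 0 < t ∧ 2 * Real.log (1 / ε) < t ^ 2 ∧
      2 * t * ((√(2 * π))⁻¹ * Real.exp (-t ^ 2 / 2)) = ε := by
  set L := Real.log (1 / ε) with hL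
  have hLpos : 1 < L := by
    rw [hL, Real.lt_log_iff_exp_lt (by positivity), lt_div_iff₀ h0]
    nlinarith [Real.exp_one_lt_d9]
  have hexp : Real.exp (-L) = ε := by
    rw [hL, one_div, Real.log_inv, neg_neg, Real.exp_log h0]
  set t₀ := √(2 * L) with ht₀
  have ht₀pos : 0 < t₀ := Real.sqrt_pos.2 (by linarith)
  have ht₀sq : t₀ ^ 2 = 2 * L := Real.sq_sqrt (by linarith)
  have hs : 0 < √(2 * π) := by positivity
  have hssq : √(2 * π) ^ 2 = 2 * π := Real.sq_sqrt (by positivity)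
  set g : ℝ → ℝ := fun t => 2 * t * ((√(2 * π))⁻¹ * Real.exp (-t ^ 2 / 2)) with hg
  have hgt : ε < g t₀ := by
    have h2 : √(2 * π) < 2 * t₀ := by
      refine lt_of_pow_lt_pow_left₀ 2 (by positivity) ?_
      rw [hssq, mul_pow, ht₀sq]
      nlinarith [Real.pi_lt_four]
    have h3 : g t₀ = (2 * t₀ / √(2 * π)) * ε := by
      simp only [hg]
      rw [show -t₀ ^ 2 / 2 = -L by linarith, hexp]
      ring
    rw [h3]
    have : 1 < 2 * t₀ / √(2 * π) := (one_lt_div hs).2 h2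
    nlinarith
  set T := max t₀ (2 / ε) with hT
  have hTpos : 0 < T := lt_max_of_lt_left ht₀pos
  have hgT : g T ≤ ε := by
    have hE : T ^ 2 / 2 * Real.exp (-T ^ 2 / 2) ≤ 1 := by
      have := Real.add_one_le_exp (T ^ 2 / 2)
      rw [show -T ^ 2 / 2 = -(T ^ 2 / 2) by ring, Real.exp_neg, ← div_eq_mul_inv,
        div_le_one (Real.exp_pos _)]
      linarith
    have hs2 : 2 ≤ √(2 * π) := by
      apply Real.le_sqrt_of_sq_le
      nlinarith [Real.pi_gt_three]
    have hinv : (√(2 * π))⁻¹ ≤ 1 / 2 := by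
      rw [one_div]; exact inv_anti₀ (by norm_num) hs2
    have hTε : 2 ≤ T * ε := by
      have := le_max_right t₀ (2 / ε)
      rwa [← hT, div_le_iff₀ h0] at this
    have hge : g T ≤ T * Real.exp (-T ^ 2 / 2) := by
      have hp : 0 ≤ T * Real.exp (-T ^ 2 / 2) := by positivity
      simp only [hg]
      nlinarith
    refine hge.trans ?_
    have : T * (T * Real.exp (-T ^ 2 / 2)) ≤ T * ε := by nlinarith
    exact le_of_mul_le_mul_left this hTpos
  have hcont : Continuous g := by fun_prop
  obtain ⟨t, ⟨ht1, _⟩, htε⟩ := intermediate_value_Icc' (le_max_left t₀ (2 / ε))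
    hcont.continuousOn ⟨hgT, hgt.le⟩
  have htlt : t₀ < t := by
    refine lt_of_le_of_ne ht1 fun h => ?_
    rw [← h] at htε
    linarith
  refine ⟨t, ht₀pos.trans htlt, ?_, htε⟩
  rw [← ht₀sq]
  exact pow_lt_pow_left₀ htlt ht₀pos.le two_ne_zero

theorem betaRingMax_bounds (n : ℕ) (x₀ : Fin n → ℝ) (hx₀ : ∑ j, x₀ j ^ 2 = 1)
    (cg : ℝ) (hcg : 0 < cg) (hcgProp : cgProperty cg)
    (α : ℝ) (hα0 : 0 < α) (hα1 : α < 1)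
    (ε : ℝ) (hε0 : 0 < ε)
    (hε : ε < min ((1 - Real.sqrt α) / 4) (min (cg ^ 2 * Real.log 2) (1 / (2 * cg ^ 2)))) :
    ((1 - Real.sqrt α) / 32) * (ε / Real.log (1 / ε)) < betaRingMax n x₀ ε α ∧
      betaRingMax n x₀ ε α < (1 / (4 * cg ^ 2)) * (ε / Real.log (1 / ε)) := by
  have hεδ : ε < (1 - √α) / 4 := hε.trans_le (min_le_left _ _)
  have hs0 : 0 < √α := Real.sqrt_pos.2 hα0
  have hε4 : ε < 1 / 4 := by linarith
  have hs2 : √α ^ 2 = α := Real.sq_sqrt hα0.le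
  have hψ : 0 < ε ^ 2 / 4 - ε ^ 3 / 6 := by nlinarith [pow_pos hε0 2]
  set L := Real.log (1 / ε) with hL
  have hL1 : 138 / 100 < L := by
    have h4 : Real.log 4 < L := Real.log_lt_log (by norm_num) (by
      rw [lt_div_iff₀ hε0]; linarith)
    rw [show (4 : ℝ) = 2 ^ 2 by norm_num, Real.log_pow] at h4
    have := Real.log_two_gt_d9
    push_cast at h4; linarith
  simp only [betaRingMax, gaussianMatrix_omegaRingEvent x₀ hx₀]
  constructor
  · set δ := 1 - √α with hδ
    have hδ0 : 0 < δ := by linarith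
    have hδ1 : δ < 1 := by linarith
    set β := δ * ε / (16 * L) with hβ
    have hβ0 : 0 < β := by positivity
    have hβ1 : β < 1 := by
      rw [hβ, div_lt_one (by positivity)]
      nlinarith
    have hlog : Real.log (1 / β) ≤ 2 * Real.log 2 + (L - 1) + 2 * L := by
      have h1 : 1 / β ≤ 2 ^ 2 * L * (1 / ε) ^ 2 := by
        rw [hβ]
        field_simp
        linarith
      have h2 := Real.log_le_log (by positivity) h1
      rw [Real.log_mul (by positivity) (by positivity), Real.log_mul (by norm_num) (by positivity),
        Real.log_pow, Real.log_pow, ← hL] at h2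
      have h3 := Real.log_le_sub_one_of_pos (show 0 < L by linarith)
      push_cast at h2
      linarith
    have hkey : β * (2 + Real.log (1 / β)) ≤
        3 / 8 * (δ * ε) - α * (ε ^ 2 / 4 - ε ^ 3 / 6) := by
      have h1 : 2 + Real.log (1 / β) ≤ 5 * L := by
        have := Real.log_two_lt_d9
        linarith
      have h2 : β * (5 * L) = 5 / 16 * (δ * ε) := by
        rw [hβ]; field_simp
      have h3 : α * (ε ^ 2 / 4 - ε ^ 3 / 6) ≤ 1 / 16 * (δ * ε) := by
        have : ε ^ 2 / 4 - ε ^ 3 / 6 ≤ 1 / 16 * (δ * ε) := by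
          nlinarith [pow_pos hε0 3]
        nlinarith
      have h4 := mul_le_mul_of_nonneg_left h1 hβ0.le
      linarith
    refine lt_of_lt_of_le ?_ (le_csSup ⟨1, fun b hb => hb.2.1.le⟩ ⟨hβ0.le, hβ1, fun m hm =>
      one_sub_le_stdGaussianPi_ringVecEvent hm hα0 hα1 hε0 (by linarith) hβ0 hβ1 hkey⟩)
    have : 0 < δ * ε / L := by positivity
    have e1 : δ / 32 * (ε / L) = 1 / 32 * (δ * ε / L) := by ring
    have e2 : β = 1 / 16 * (δ * ε / L) := by rw [hβ]; field_simp
    rw [e1, e2]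
    linarith
  · obtain ⟨t, ht0, htL, htε⟩ := exists_two_mul_gaussian_eq hε0 hε4
    set S : Set ℝ := {y | t < |y|} with hS
    set p := (gaussianReal 0 1).real S with hp
    have hp0 : 0 < p := gaussianReal_real_lt_abs_pos t
    have hsup : sSup {β : ℝ | 0 ≤ β ∧ β < 1 ∧ ∀ m : ℕ, 0 < m →
        ENNReal.ofReal (1 - 3 * Real.exp (-α * (ε ^ 2 / 4 - ε ^ 3 / 6) * m)) ≤
          stdGaussianPi m (ringVecEvent m ε β)} ≤ p := by
      refine Real.sSup_le (fun β hβ => ?_) hp0.le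
      by_contra! hlt
      have h := one_sub_le_integral_indicator_compl_sq (measurableSet_setOf_lt_abs t)
        (κ := α * (ε ^ 2 / 4 - ε ^ 3 / 6)) (by linarith : ε < 1) hlt hβ.2.1 (by positivity)
        (fun m hm => by simpa only [neg_mul] using hβ.2.2 m hm)
      rw [integral_indicator_compl_sq_gaussianReal ht0.le, htε] at h
      linarith
    refine hsup.trans_lt ?_
    have hc := sq_le_half_of_cgProperty hcg hcgProp
    have hmill := gaussianReal_real_lt_abs_le ht0
    have h1 : p ≤ ε / t ^ 2 := by
      refine hmill.trans_eq ?_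
      rw [← htε]
      field_simp
    have h2 : ε / t ^ 2 < ε / (2 * L) := div_lt_div_of_pos_left hε0 (by linarith) htL
    have h3 : ε / (2 * L) ≤ 1 / (4 * cg ^ 2) * (ε / L) := by
      rw [one_div_mul_eq_div, div_div]
      refine div_le_div_of_nonneg_left hε0.le (by positivity) ?_
      nlinarith
    linarith
end

section
/- (Robust Johnson–Lindenstrauss lemma) Let 0 < α < 1 and 0 < ε < (1 − √α)/4. Let N, m, n ∈ ℕ with m > ln(3N(N−1)/2)/(α(ε²/4 − ε³/6)), and let A be an m×n Gaussian random matrix. For any N points p₁,…,p_N ∈ ℝ^n, with probability at least 1 − (3/2)N(N−1)e^{−α(ε²/4 − ε³/6)m} > 0, for all 1 ≤ j, k ≤ N and all T ⊆ {1,…,m} with |T^c| ≤ m·((1 − √α)/32)·ε/ln(1/ε), one has (1 − ε)‖p_j − p_k‖² ≤ (1/m)‖A_T p_j − A_T p_k‖² ≤ (1 + ε)‖p_j − p_k‖². -/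
open MeasureTheory ProbabilityTheory Real

/-- Chernoff's bound for a sum of i.i.d. random variables. -/
lemma measure_pi_le_sum_le {Ω ι : Type*} [Fintype ι] [MeasurableSpace Ω] (μ : Measure Ω)
    [IsProbabilityMeasure μ] {g : Ω → ℝ} {b : ℝ} (hg : Integrable (fun x => exp (g x)) μ)
    (hb : ∫ x, exp (g x) ∂μ ≤ exp b) (a : ℝ) :
    Measure.pi (fun _ : ι => μ) {y | a ≤ ∑ i, g (y i)} ≤
      ENNReal.ofReal (exp (Fintype.card ι * b - a)) := by
  have hint : Integrable (fun y : ι → Ω => ∏ i, exp (g (y i))) (Measure.pi fun _ : ι => μ) :=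
    Integrable.fintype_prod (f := fun _ x => exp (g x)) fun _ => hg
  have hmarkov := mul_meas_ge_le_integral_of_nonneg
    (μ := Measure.pi fun _ : ι => μ) (f := fun y : ι → Ω => ∏ i, exp (g (y i)))
    (Filter.Eventually.of_forall fun y => by positivity) hint (exp a)
  rw [integral_fintype_prod_eq_pow (f := fun x => exp (g x))] at hmarkov
  have hpow : (∫ x, exp (g x) ∂μ) ^ Fintype.card ι ≤ exp (Fintype.card ι * b) := by
    rw [exp_nat_mul]
    exact pow_le_pow_left₀ (integral_nonneg fun x => (exp_pos _).le) hb _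
  have hset : {y : ι → Ω | exp a ≤ ∏ i, exp (g (y i))} = {y | a ≤ ∑ i, g (y i)} := by
    ext y
    simp [← exp_sum]
  rw [hset] at hmarkov
  rw [← ofReal_measureReal]
  apply ENNReal.ofReal_le_ofReal
  rw [exp_sub, le_div_iff₀ (exp_pos a)]
  linarith

lemma integrable_exp_mul_sq_gaussianReal_s2 {c : ℝ} (hc : c < 1 / 2) :
    Integrable (fun x => exp (c * x ^ 2)) (gaussianReal 0 1) := by
  rw [gaussianReal_of_var_ne_zero _ one_ne_zero]
  rw [integrable_withDensity_iff_integrable_smul' (measurable_gaussianPDF 0 1)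
    (Filter.Eventually.of_forall fun _ => gaussianPDF_lt_top)]
  have h := (integrable_exp_neg_mul_sq (b := 1 / 2 - c) (by linarith)).const_mul (√(2 * π))⁻¹
  refine h.congr (Filter.Eventually.of_forall fun x => ?_)
  simp only [toReal_gaussianPDF, gaussianPDFReal, smul_eq_mul, NNReal.coe_one, mul_assoc,
    ← exp_add]
  ring_nf

lemma integral_exp_mul_sq_gaussianReal_s2 {c : ℝ} (hc : c < 1 / 2) :
    ∫ x, exp (c * x ^ 2) ∂(gaussianReal 0 1) = √(1 / (1 - 2 * c)) := by
  rw [integral_gaussianReal_eq_integral_smul one_ne_zero]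
  have : ∀ x : ℝ, gaussianPDFReal 0 1 x • exp (c * x ^ 2) =
      (√(2 * π))⁻¹ * exp (-(1 / 2 - c) * x ^ 2) := fun x => by
    simp only [gaussianPDFReal, smul_eq_mul, NNReal.coe_one, mul_assoc, ← exp_add]
    ring_nf
  simp_rw [this]
  rw [integral_const_mul, integral_gaussian, ← sqrt_inv, ← sqrt_mul (by positivity)]
  congr 1
  have : 1 - 2 * c ≠ 0 := by linarith
  have : 1 / 2 - c ≠ 0 := by linarith
  have := pi_ne_zero
  field_simp

/-- A unit linear combination of independent standard normal variables is standard normal. -/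
lemma map_sum_mul_pi_gaussianReal {ι : Type*} [Fintype ι] {x : ι → ℝ} (hx : ∑ j, x j ^ 2 = 1) :
    (Measure.pi fun _ : ι => gaussianReal 0 1).map (fun a => ∑ j, a j * x j) =
      gaussianReal 0 1 := by
  have hmeas : Measurable (fun a : ι → ℝ => ∑ j, a j * x j) := by fun_prop
  have : IsProbabilityMeasure ((Measure.pi fun _ : ι => gaussianReal 0 1).map
      (fun a => ∑ j, a j * x j)) := Measure.isProbabilityMeasure_map hmeas.aemeasurable
  apply Measure.ext_of_charFun
  ext t
  rw [charFun_apply_real, integral_map hmeas.aemeasurable (by fun_prop)]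
  have h : ∀ a : ι → ℝ, Complex.exp (t * ((∑ j, a j * x j : ℝ) : ℂ) * Complex.I) =
      ∏ j, Complex.exp (((t * x j : ℝ) : ℂ) * a j * Complex.I) := fun a => by
    rw [← Complex.exp_sum, Complex.ofReal_sum, Finset.mul_sum, Finset.sum_mul]
    congr 1
    refine Finset.sum_congr rfl fun j _ => ?_
    push_cast
    ring
  simp_rw [h]
  rw [integral_fintype_prod_eq_prod
    (f := fun j (y : ℝ) => Complex.exp (((t * x j : ℝ) : ℂ) * y * Complex.I))]
  simp_rw [← charFun_apply_real, charFun_gaussianReal]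
  rw [← Complex.exp_sum]
  congr 1
  have hx' : ∑ j, (x j : ℂ) ^ 2 = 1 := by exact_mod_cast hx
  simp only [Complex.ofReal_zero, mul_zero, zero_mul, zero_sub, NNReal.coe_one, Complex.ofReal_one,
    one_mul, Complex.ofReal_mul, mul_pow]
  rw [Finset.sum_neg_distrib, ← Finset.sum_div, ← Finset.mul_sum, hx', mul_one]

/-- A Gaussian matrix maps a unit vector to a standard normal vector. -/
lemma map_mulVec_gaussianMatrix (m : ℕ) {n : ℕ} {x : Fin n → ℝ} (hx : ∑ j, x j ^ 2 = 1) :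
    (gaussianMatrix m n).map (fun A i => ∑ j, A i j * x j) =
      Measure.pi fun _ : Fin m => gaussianReal 0 1 := by
  have h := map_sum_mul_pi_gaussianReal hx
  have : ∀ i : Fin m, SigmaFinite ((Measure.pi fun _ : Fin n => gaussianReal 0 1).map
      (fun a => ∑ j, a j * x j)) := fun _ => by rw [h]; infer_instance
  have hmeas : Measurable (fun a : Fin n → ℝ => ∑ j, a j * x j) := by fun_prop
  have hpi := Measure.pi_map_pi (ι := Fin m) (μ := fun _ => Measure.pi fun _ : Fin n =>
    gaussianReal 0 1) (f := fun _ a => ∑ j, a j * x j) fun _ => hmeas.aemeasurable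
  simp_rw [h] at hpi
  exact hpi

lemma log_one_add_le_cubic {x : ℝ} (hx : 0 ≤ x) : log (1 + x) ≤ x - x ^ 2 / 2 + x ^ 3 / 3 := by
  have hd : ∀ y : ℝ, 0 ≤ y → HasDerivAt (fun y => y - y ^ 2 / 2 + y ^ 3 / 3 - log (1 + y))
      (y ^ 3 / (1 + y)) y := fun y hy => by
    have h1 : (1 + y) ≠ 0 := by positivity
    have := (((hasDerivAt_id y).sub ((hasDerivAt_pow 2 y).div_const 2)).add
      ((hasDerivAt_pow 3 y).div_const 3)).sub (((hasDerivAt_id y).const_add 1).log h1)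
    refine this.congr_deriv ?_
    norm_num
    field_simp
    ring
  have hmono : MonotoneOn (fun y => y - y ^ 2 / 2 + y ^ 3 / 3 - log (1 + y)) (Set.Ici 0) := by
    refine monotoneOn_of_deriv_nonneg (convex_Ici 0)
      (fun y hy => (hd y hy).continuousAt.continuousWithinAt) ?_ ?_
    · intro y hy
      rw [interior_Ici] at hy
      exact (hd y hy.le).differentiableAt.differentiableWithinAt
    · intro y hy
      rw [interior_Ici] at hy
      rw [(hd y hy.le).deriv]
      have : 0 < y := hy
      positivity
  have := hmono Set.self_mem_Ici hx hx
  simp at this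
  linarith

lemma log_one_sub_le_quadratic {x : ℝ} (hx : 0 ≤ x) (hx1 : x < 1) :
    log (1 - x) ≤ -x - x ^ 2 / 2 := by
  have h := sum_le_hasSum (Finset.range 2) (fun i _ => by positivity)
    (hasSum_pow_div_log_of_abs_lt_one (by rwa [abs_of_nonneg hx]))
  norm_num [Finset.sum_range_succ] at h
  linarith

lemma pi_gaussianReal_upper_tail (m : ℕ) {ε : ℝ} (hε : 0 ≤ ε) :
    Measure.pi (fun _ : Fin m => gaussianReal 0 1) {y | (1 + ε) * m ≤ ∑ i, y i ^ 2} ≤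
      ENNReal.ofReal (exp (-(ε ^ 2 / 4 - ε ^ 3 / 6) * m)) := by
  set c := ε / (2 * (1 + ε)) with hc
  have h1 : 0 < 1 + ε := by positivity
  have hc2 : 1 - 2 * c = 1 / (1 + ε) := by rw [hc]; field_simp; ring
  have hlt : c < 1 / 2 := by
    have : 0 < 1 / (1 + ε) := by positivity
    linarith
  have hb : ∫ x, exp (c * x ^ 2) ∂(gaussianReal 0 1) ≤ exp (log (1 + ε) / 2) := by
    rw [integral_exp_mul_sq_gaussianReal_s2 hlt, hc2, one_div_one_div, exp_half, exp_log h1]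
  refine (measure_mono ?_).trans ((measure_pi_le_sum_le _ (integrable_exp_mul_sq_gaussianReal_s2 hlt)
    hb (ε / 2 * m)).trans (ENNReal.ofReal_le_ofReal (exp_le_exp.2 ?_)))
  · intro y hy
    simp only [Set.mem_ofPred_eq] at hy ⊢
    rw [← Finset.mul_sum]
    have hc0 : 0 ≤ c := by positivity
    calc ε / 2 * m = c * ((1 + ε) * m) := by rw [hc]; field_simp
      _ ≤ _ := mul_le_mul_of_nonneg_left hy hc0
  · rw [Fintype.card_fin]
    have := mul_le_mul_of_nonneg_left (log_one_add_le_cubic hε) (Nat.cast_nonneg (α := ℝ) m)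
    nlinarith

lemma pi_gaussianReal_lower_tail (m : ℕ) {δ : ℝ} (hδ : 0 ≤ δ) (hδ1 : δ < 1) :
    Measure.pi (fun _ : Fin m => gaussianReal 0 1) {y | ∑ i, y i ^ 2 ≤ (1 - δ) * m} ≤
      ENNReal.ofReal (exp (-(δ ^ 2 / 4) * m)) := by
  set c := δ / (2 * (1 - δ)) with hc
  have h1 : 0 < 1 - δ := by linarith
  have hc0 : 0 ≤ c := by positivity
  have hc2 : 1 - 2 * (-c) = 1 / (1 - δ) := by rw [hc]; field_simp; ring
  have hlt : -c < 1 / 2 := by linarith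
  have hb : ∫ x, exp (-c * x ^ 2) ∂(gaussianReal 0 1) ≤ exp (log (1 - δ) / 2) := by
    rw [integral_exp_mul_sq_gaussianReal_s2 hlt, hc2, one_div_one_div, exp_half, exp_log h1]
  refine (measure_mono ?_).trans ((measure_pi_le_sum_le _ (integrable_exp_mul_sq_gaussianReal_s2 hlt)
    hb (-(δ / 2 * m))).trans (ENNReal.ofReal_le_ofReal (exp_le_exp.2 ?_)))
  · intro y hy
    simp only [Set.mem_ofPred_eq] at hy ⊢
    rw [← Finset.mul_sum]
    have h2 : δ / 2 * m = c * ((1 - δ) * m) := by rw [hc]; field_simp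
    rw [h2, neg_mul]
    exact neg_le_neg (mul_le_mul_of_nonneg_left hy hc0)
  · rw [Fintype.card_fin]
    have := mul_le_mul_of_nonneg_left (log_one_sub_le_quadratic hδ hδ1)
      (Nat.cast_nonneg (α := ℝ) m)
    nlinarith

/-- Tail bound for the total excess of the squares of a standard normal vector over the level
`12 log (1 / ε)`. -/
lemma pi_gaussianReal_excess_tail (m : ℕ) {ε : ℝ} (hε : 0 < ε) (a : ℝ) :
    Measure.pi (fun _ : Fin m => gaussianReal 0 1)
        {y | a ≤ ∑ i, max 0 ((y i ^ 2 - 12 * log (1 / ε)) / 4)} ≤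
      ENNReal.ofReal (exp (m * (3 / 2 * ε ^ 3) - a)) := by
  have hle : ∀ x : ℝ, exp (max 0 ((x ^ 2 - 12 * log (1 / ε)) / 4)) ≤
      1 + ε ^ 3 * exp (1 / 4 * x ^ 2) := fun x => by
    have h : exp ((x ^ 2 - 12 * log (1 / ε)) / 4) = ε ^ 3 * exp (1 / 4 * x ^ 2) := by
      rw [one_div, log_inv, ← exp_log (pow_pos hε 3), ← exp_add, log_pow]
      congr 1
      push_cast
      ring
    rcases max_cases 0 ((x ^ 2 - 12 * log (1 / ε)) / 4) with h' | h'
    · rw [h'.1, exp_zero]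
      have : 0 < ε ^ 3 * exp (1 / 4 * x ^ 2) := by positivity
      linarith
    · rw [h'.1, h]
      linarith
  have hI := integrable_exp_mul_sq_gaussianReal_s2 (c := 1 / 4) (by norm_num)
  have hI' : Integrable (fun x => 1 + ε ^ 3 * exp (1 / 4 * x ^ 2)) (gaussianReal 0 1) :=
    (integrable_const 1).add (hI.const_mul _)
  have hint : Integrable (fun x => exp (max 0 ((x ^ 2 - 12 * log (1 / ε)) / 4)))
      (gaussianReal 0 1) := by
    refine hI'.mono' (by fun_prop) (Filter.Eventually.of_forall fun x => ?_)
    rw [norm_of_nonneg (exp_pos _).le]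
    exact hle x
  have hb : ∫ x, exp (max 0 ((x ^ 2 - 12 * log (1 / ε)) / 4)) ∂(gaussianReal 0 1) ≤
      exp (3 / 2 * ε ^ 3) := by
    refine (integral_mono hint hI' hle).trans ?_
    rw [integral_add (integrable_const 1) (hI.const_mul _), integral_const_mul,
      integral_exp_mul_sq_gaussianReal_s2 (by norm_num)]
    have hs : √(1 / (1 - 2 * (1 / 4) : ℝ)) ≤ 3 / 2 := by
      rw [sqrt_le_left (by norm_num)]
      norm_num
    have := mul_le_mul_of_nonneg_left hs (pow_pos hε 3).le
    have := add_one_le_exp (3 / 2 * ε ^ 3)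
    simp only [integral_const, probReal_univ, smul_eq_mul, mul_one]
    linarith
  simpa using measure_pi_le_sum_le (ι := Fin m) (gaussianReal 0 1) hint hb a

lemma sum_compl_bounds {m : ℕ} {α ε : ℝ} (hε0 : 0 < ε) (hε : ε < (1 - √α) / 4) {y : Fin m → ℝ}
    (hup : ∑ i, y i ^ 2 < (1 + ε) * m) (hlow : (1 - √α * ε) * m < ∑ i, y i ^ 2)
    (hex : ∑ i, max 0 ((y i ^ 2 - 12 * log (1 / ε)) / 4) < 5 / 32 * ((1 - √α) * ε) * m)
    (T : Finset (Fin m))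
    (hT : (Tᶜ.card : ℝ) ≤ m * ((1 - √α) / 32) * (ε / log (1 / ε))) :
    (1 - ε) * m ≤ ∑ i ∈ T, y i ^ 2 ∧ ∑ i ∈ T, y i ^ 2 ≤ (1 + ε) * m := by
  have hε1 : ε < 1 := by linarith [sqrt_nonneg α]
  have hL : 0 < log (1 / ε) := log_pos (by rwa [one_div, one_lt_inv₀ hε0])
  have hsplit := Finset.sum_add_sum_compl T (fun i => y i ^ 2)
  have hnn : 0 ≤ ∑ i ∈ Tᶜ, y i ^ 2 := Finset.sum_nonneg fun i _ => sq_nonneg _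
  refine ⟨?_, by linarith⟩
  have h1 : ∑ i ∈ Tᶜ, y i ^ 2 ≤
      Tᶜ.card * (12 * log (1 / ε)) + 4 * ∑ i, max 0 ((y i ^ 2 - 12 * log (1 / ε)) / 4) := by
    calc ∑ i ∈ Tᶜ, y i ^ 2
        ≤ ∑ i ∈ Tᶜ, (12 * log (1 / ε) + 4 * max 0 ((y i ^ 2 - 12 * log (1 / ε)) / 4)) :=
          Finset.sum_le_sum fun i _ => by
            linarith [le_max_right (0 : ℝ) ((y i ^ 2 - 12 * log (1 / ε)) / 4)]
      _ = Tᶜ.card * (12 * log (1 / ε)) +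
            4 * ∑ i ∈ Tᶜ, max 0 ((y i ^ 2 - 12 * log (1 / ε)) / 4) := by
          rw [Finset.sum_add_distrib, Finset.sum_const, nsmul_eq_mul, Finset.mul_sum]
      _ ≤ _ := by
          gcongr
          exact Finset.subset_univ _
  have h2 : Tᶜ.card * (12 * log (1 / ε)) ≤ 12 / 32 * ((1 - √α) * ε) * m := by
    calc _ ≤ m * ((1 - √α) / 32) * (ε / log (1 / ε)) * (12 * log (1 / ε)) := by gcongr
      _ = _ := by field_simp
  linarith

/-- Failure of the robust Johnson–Lindenstrauss estimate for the vector `x`. -/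
def robustFailure (α ε : ℝ) (m : ℕ) {n : ℕ} (x : Fin n → ℝ) : Set (Fin m → Fin n → ℝ) :=
  {A | ¬ ∀ T : Finset (Fin m),
    (Tᶜ.card : ℝ) ≤ m * ((1 - √α) / 32) * (ε / log (1 / ε)) →
    (1 - ε) * (∑ l, x l ^ 2) ≤ (1 / (m : ℝ)) * subNormSq A x T ∧
      (1 / (m : ℝ)) * subNormSq A x T ≤ (1 + ε) * (∑ l, x l ^ 2)}

lemma robustFailure_smul {α ε : ℝ} {m n : ℕ} (x : Fin n → ℝ) {c : ℝ} (hc : c ≠ 0) :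
    robustFailure α ε m (c • x) = robustFailure α ε m x := by
  have hc2 : 0 < c ^ 2 := by positivity
  have h1 : ∑ l, (c • x) l ^ 2 = c ^ 2 * ∑ l, x l ^ 2 := by
    simp only [Pi.smul_apply, smul_eq_mul, mul_pow, Finset.mul_sum]
  have h2 : ∀ (A : Fin m → Fin n → ℝ) T, subNormSq A (c • x) T = c ^ 2 * subNormSq A x T := by
    intro A T
    simp only [subNormSq, Finset.mul_sum, ← mul_pow, Pi.smul_apply, smul_eq_mul]
    refine Finset.sum_congr rfl fun i _ => ?_
    congr 1
    exact Finset.sum_congr rfl fun j _ => by ring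
  simp only [robustFailure, h1, h2, mul_left_comm _ (c ^ 2), mul_le_mul_iff_right₀ hc2]

lemma gaussianMatrix_robustFailure_le_of_unit {α ε : ℝ} (hα0 : 0 < α) (hα1 : α < 1) (hε0 : 0 < ε)
    (hε : ε < (1 - √α) / 4) {m n : ℕ} (hm : 0 < m) {x : Fin n → ℝ} (hx : ∑ j, x j ^ 2 = 1) :
    gaussianMatrix m n (robustFailure α ε m x) ≤
      ENNReal.ofReal (3 * exp (-α * (ε ^ 2 / 4 - ε ^ 3 / 6) * m)) := by
  have hs0 := sqrt_nonneg α
  have hsq := sq_sqrt hα0.le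
  have hs1 : √α < 1 := by nlinarith
  have hε4 : ε < 1 / 4 := by linarith
  have hm0 : (0 : ℝ) < m := by exact_mod_cast hm
  set P := Measure.pi fun _ : Fin m => gaussianReal 0 1
  set E := ENNReal.ofReal (exp (-α * (ε ^ 2 / 4 - ε ^ 3 / 6) * m)) with hE
  set U : Set (Fin m → ℝ) := {y | (1 + ε) * m ≤ ∑ i, y i ^ 2}
  set V : Set (Fin m → ℝ) := {y | ∑ i, y i ^ 2 ≤ (1 - √α * ε) * m}
  set W : Set (Fin m → ℝ) :=
    {y | 5 / 32 * ((1 - √α) * ε) * m ≤ ∑ i, max 0 ((y i ^ 2 - 12 * log (1 / ε)) / 4)}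
  have hD : 0 < ε ^ 2 / 4 - ε ^ 3 / 6 := by
    have : ε ^ 3 ≤ ε ^ 2 * (1 / 4) := by nlinarith [pow_pos hε0 2]
    nlinarith [pow_pos hε0 2]
  have hU : P U ≤ E := by
    refine (pi_gaussianReal_upper_tail m hε0.le).trans
      (ENNReal.ofReal_le_ofReal (exp_le_exp.2 ?_))
    gcongr
    nlinarith
  have hV : P V ≤ E := by
    refine (pi_gaussianReal_lower_tail m (δ := √α * ε) (by positivity) (by nlinarith)).trans
      (ENNReal.ofReal_le_ofReal (exp_le_exp.2 ?_))
    gcongr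
    rw [mul_pow, hsq]
    nlinarith [mul_pos hα0 (pow_pos hε0 3)]
  have hW : P W ≤ E := by
    refine (pi_gaussianReal_excess_tail m hε0 _).trans
      (ENNReal.ofReal_le_ofReal (exp_le_exp.2 ?_))
    have h1 : ε ^ 3 ≤ ε ^ 2 * (1 / 4) := by nlinarith [pow_pos hε0 2]
    have h2 : 4 * ε ^ 2 ≤ (1 - √α) * ε := by nlinarith
    have h3 : α * (ε ^ 2 / 4 - ε ^ 3 / 6) ≤ ε ^ 2 / 4 := by nlinarith [pow_pos hε0 3]
    have h4 : 3 / 2 * ε ^ 3 - 5 / 32 * ((1 - √α) * ε) ≤ -α * (ε ^ 2 / 4 - ε ^ 3 / 6) := by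
      linarith
    nlinarith
  have hsub : robustFailure α ε m x ⊆ (fun A i => ∑ j, A i j * x j) ⁻¹' (U ∪ V ∪ W) := by
    intro A hA
    by_contra hcon
    simp only [Set.mem_preimage, Set.mem_union, not_or, U, V, W, Set.mem_ofPred_eq, not_le] at hcon
    refine hA fun T hT => ?_
    have := sum_compl_bounds hε0 hε hcon.1.1 hcon.1.2 hcon.2 T hT
    rw [hx, mul_one, mul_one, one_div, inv_mul_eq_div, le_div_iff₀ hm0, div_le_iff₀ hm0]
    exact this
  calc gaussianMatrix m n (robustFailure α ε m x)
      ≤ gaussianMatrix m n ((fun A i => ∑ j, A i j * x j) ⁻¹' (U ∪ V ∪ W)) := measure_mono hsub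
    _ ≤ (gaussianMatrix m n).map (fun A i => ∑ j, A i j * x j) (U ∪ V ∪ W) :=
        Measure.le_map_apply (Measurable.aemeasurable (by fun_prop)) _
    _ = P (U ∪ V ∪ W) := by rw [map_mulVec_gaussianMatrix m hx]
    _ ≤ P U + P V + P W :=
        (measure_union_le _ _).trans (add_le_add_left (measure_union_le _ _) _)
    _ ≤ E + E + E := by gcongr
    _ = _ := by
        rw [ENNReal.ofReal_mul (by norm_num), ← hE, ENNReal.ofReal_ofNat]
        ring

lemma gaussianMatrix_robustFailure_le {α ε : ℝ} (hα0 : 0 < α) (hα1 : α < 1) (hε0 : 0 < ε)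
    (hε : ε < (1 - √α) / 4) {m n : ℕ} (hm : 0 < m) (x : Fin n → ℝ) :
    gaussianMatrix m n (robustFailure α ε m x) ≤
      ENNReal.ofReal (3 * exp (-α * (ε ^ 2 / 4 - ε ^ 3 / 6) * m)) := by
  have hnn : 0 ≤ ∑ j, x j ^ 2 := Finset.sum_nonneg fun j _ => sq_nonneg _
  rcases hnn.eq_or_lt with h0 | hpos
  · have hx : x = 0 := by
      funext j
      have := (Finset.sum_eq_zero_iff_of_nonneg fun j _ => sq_nonneg (x j)).1 h0.symm j
        (Finset.mem_univ j)
      simpa using this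
    have : robustFailure α ε m x = ∅ := by
      simp [robustFailure, hx, subNormSq]
    simp [this]
  · have hr : 0 < √(∑ j, x j ^ 2) := sqrt_pos.2 hpos
    rw [← robustFailure_smul x (inv_ne_zero hr.ne')]
    refine gaussianMatrix_robustFailure_le_of_unit hα0 hα1 hε0 hε hm ?_
    simp only [Pi.smul_apply, smul_eq_mul, mul_pow, ← Finset.mul_sum, inv_pow, sq_sqrt hnn]
    exact inv_mul_cancel₀ hpos.ne'

lemma two_mul_card_filter_lt (N : ℕ) :
    2 * ((Finset.univ.filter fun q : Fin N × Fin N => q.1 < q.2).card : ℝ) =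
      N * ((N : ℝ) - 1) := by
  have h : (Finset.univ.filter fun q : Fin N × Fin N => q.1 < q.2).card =
      ∑ k ∈ Finset.range N, k := by
    rw [Finset.card_filter, Fintype.sum_prod_type_right, ← Fin.sum_univ_eq_sum_range (fun k => k)]
    refine Finset.sum_congr rfl fun k _ => ?_
    rw [← Finset.card_filter, Finset.filter_gt_eq_Iio, Fin.card_Iio]
  have h2 := Finset.sum_range_id_mul_two N
  rw [h]
  rcases N with _ | N
  · simp
  · rw [Nat.add_sub_cancel] at h2
    have h3 : ((∑ k ∈ Finset.range (N + 1), k : ℕ) : ℝ) * 2 = (N + 1 : ℕ) * N := by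
      exact_mod_cast h2
    push_cast at h3 ⊢
    linarith

/-- Robust Johnson–Lindenstrauss lemma. -/
theorem robust_JL (α ε : ℝ) (hα0 : 0 < α) (hα1 : α < 1)
    (hε0 : 0 < ε) (hε : ε < (1 - Real.sqrt α) / 4)
    (N m n : ℕ)
    (hm : (m : ℝ) > Real.log (3 * N * (N - 1) / 2) / (α * (ε ^ 2 / 4 - ε ^ 3 / 6)))
    (p : Fin N → Fin n → ℝ) :
    0 < 1 - (3 / 2) * N * ((N : ℝ) - 1) * Real.exp (-α * (ε ^ 2 / 4 - ε ^ 3 / 6) * m) ∧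
    ENNReal.ofReal (1 - (3 / 2) * N * ((N : ℝ) - 1) * Real.exp (-α * (ε ^ 2 / 4 - ε ^ 3 / 6) * m)) ≤
      gaussianMatrix m n
        {A | ∀ j k : Fin N, ∀ T : Finset (Fin m),
          (Tᶜ.card : ℝ) ≤ m * ((1 - Real.sqrt α) / 32) * (ε / Real.log (1 / ε)) →
          (1 - ε) * (∑ l, (p j l - p k l) ^ 2) ≤
              (1 / (m : ℝ)) * subNormSq A (fun l => p j l - p k l) T ∧
            (1 / (m : ℝ)) * subNormSq A (fun l => p j l - p k l) T ≤
              (1 + ε) * (∑ l, (p j l - p k l) ^ 2)} := by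
  have hD : 0 < ε ^ 2 / 4 - ε ^ 3 / 6 := by
    have hε4 : ε < 1 / 4 := by linarith [sqrt_nonneg α]
    have : ε ^ 3 ≤ ε ^ 2 * (1 / 4) := by nlinarith [pow_pos hε0 2]
    nlinarith [pow_pos hε0 2]
  have hαD : 0 < α * (ε ^ 2 / 4 - ε ^ 3 / 6) := mul_pos hα0 hD
  have hcases : (N : ℝ) * (N - 1) = 0 ∨ 2 ≤ (N : ℝ) * (N - 1) := by
    rcases Nat.lt_or_ge N 2 with h | h
    · left
      interval_cases N <;> simp
    · right
      have : (2 : ℝ) ≤ N := by exact_mod_cast h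
      nlinarith
  have hm0 : 0 < m := by
    have h : (0 : ℝ) ≤ log (3 * N * (N - 1) / 2) := by
      rw [mul_assoc]
      rcases hcases with h | h
      · simp [h]
      · exact log_nonneg (by linarith)
    have : (0 : ℝ) < m := lt_of_le_of_lt (div_nonneg h hαD.le) hm
    exact_mod_cast this
  set e := exp (-α * (ε ^ 2 / 4 - ε ^ 3 / 6) * m) with he
  refine ⟨?_, ?_⟩
  · rw [mul_assoc (3 / 2 : ℝ)]
    rcases hcases with h | h
    · simp [h]
    · rw [gt_iff_lt, div_lt_iff₀ hαD, log_lt_iff_lt_exp (by rw [mul_assoc]; linarith)] at hm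
      have he' : e = (exp (m * (α * (ε ^ 2 / 4 - ε ^ 3 / 6))))⁻¹ := by
        rw [he, ← exp_neg]
        ring_nf
      rw [he', ← div_eq_mul_inv, sub_pos, div_lt_one (exp_pos _)]
      linarith
  · set S : Set (Fin m → Fin n → ℝ) := _
    change _ ≤ gaussianMatrix m n S
    have : IsProbabilityMeasure (gaussianMatrix m n) := by
      unfold gaussianMatrix
      infer_instance
    set F := Finset.univ.filter fun q : Fin N × Fin N => q.1 < q.2
    have hcompl : Sᶜ ⊆ ⋃ q ∈ F, robustFailure α ε m (fun l => p q.1 l - p q.2 l) := by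
      intro A hA
      by_contra hcon
      simp only [F, Set.mem_iUnion, Finset.mem_filter, Finset.mem_univ, true_and, not_exists,
        Prod.forall, robustFailure, Set.mem_ofPred_eq, not_not] at hcon
      refine hA fun j k => ?_
      rcases lt_trichotomy j k with h | h | h
      · exact hcon j k h
      · intro T _
        simp [h, subNormSq]
      · have hs := hcon k j h
        have h1 : ∀ l, (p k l - p j l) ^ 2 = (p j l - p k l) ^ 2 := fun l => by ring
        have h2 : ∀ T, subNormSq A (fun l => p k l - p j l) T =
            subNormSq A (fun l => p j l - p k l) T := fun T => by
          refine Finset.sum_congr rfl fun i _ => ?_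
          rw [← neg_sq, ← Finset.sum_neg_distrib]
          congr 1
          exact Finset.sum_congr rfl fun l _ => by ring
        simpa only [h1, h2] using hs
    have hbad : gaussianMatrix m n Sᶜ ≤ ENNReal.ofReal ((3 / 2) * N * ((N : ℝ) - 1) * e) := by
      calc gaussianMatrix m n Sᶜ
          ≤ ∑ q ∈ F, gaussianMatrix m n (robustFailure α ε m (fun l => p q.1 l - p q.2 l)) :=
            (measure_mono hcompl).trans (measure_biUnion_finset_le _ _)
        _ ≤ ∑ _q ∈ F, ENNReal.ofReal (3 * e) := Finset.sum_le_sum fun q _ =>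
            gaussianMatrix_robustFailure_le hα0 hα1 hε0 hε hm0 _
        _ = ENNReal.ofReal (F.card * (3 * e)) := by
            rw [Finset.sum_const, nsmul_eq_mul, ENNReal.ofReal_mul (Nat.cast_nonneg _),
              ENNReal.ofReal_natCast]
        _ = _ := by
            congr 1
            linear_combination (3 / 2 * e) * two_mul_card_filter_lt N
    have hone : 1 ≤ gaussianMatrix m n S + gaussianMatrix m n Sᶜ := by
      rw [← measure_univ (μ := gaussianMatrix m n), ← Set.union_compl_self S]
      exact measure_union_le _ _
    rw [ENNReal.ofReal_sub _ (by
      rw [mul_assoc (3 / 2 : ℝ)]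
      rcases hcases with h | h
      · simp [h]
      · positivity), ENNReal.ofReal_one, tsub_le_iff_right]
    exact hone.trans (by gcongr)
end
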